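/- Let d ≥ 1, 0 < q < ∞, s > τ_q := d/min(1,q) − d, and A > 1. Then there exist h ∈ ℕ (depending only on A) and a constant C (independent of μ, P, and the family (f_k)) such that the following holds: for every μ ∈ ℕ, every dyadic cube P ∈ D_μ, and every sequence (f_k)_{k≥0} of tempered distributions with supp f̂_k ⊂ {ξ : |ξ| ≤ A·2^k} for all k ≥ 0 (so that each f_k is a smooth function of polynomial growth) such that Σ_{k=0}^∞ f_k converges in S′, one has (|P|^{−1} ∫_P Σ_{n=μ}^∞ 2^{snq} |Π_n (Σ_{k=0}^∞ f_k)(x)|^q dx)^{1/q} ≤ C · sup_{R∈D_μ} (|R|^{−1} ∫_R Σ_{k=max(0,μ−h)}^∞ 2^{skq} |f_k(x)|^q dx)^{1/q}. -/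

import Mathlib

noncomputable section

open MeasureTheory SchwartzMap Complex RealInnerProductSpace Filter
open scoped ENNReal NNReal ContDiff SchwartzMap

/-- Euclidean space `ℝ^d`. -/
abbrev RD (d : ℕ) : Type := EuclideanSpace ℝ (Fin d)

/-- Tempered distributions on `ℝ^d`. -/
abbrev TD (d : ℕ) : Type := 𝓢(RD d, ℂ) →L[ℂ] ℂ

/-- Fourier transform of a Schwartz function (with the convention
`f̂(ξ) = ∫ f(x) e^{-2πi⟨x,ξ⟩} dx`). -/
def fourierS {d : ℕ} (f : 𝓢(RD d, ℂ)) : 𝓢(RD d, ℂ) :=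
  SchwartzMap.fourierTransformCLM ℂ f

/-- Hörmander symbol class `S^m_{1,1}`: `a` is smooth and
`‖∂_ξ^α ∂_x^β a(x,ξ)‖ ≤ c_{α,β} (1+‖ξ‖)^{m-|α|+|β|}` for all orders of derivatives. -/
def IsSymbolS11 (d : ℕ) (m : ℝ) (a : RD d → RD d → ℂ) : Prop :=
  ContDiff ℝ ∞ (fun p : RD d × RD d => a p.1 p.2) ∧
  ∀ α β : ℕ, ∃ c : ℝ, ∀ x ξ : RD d,
    ‖iteratedFDeriv ℝ α (fun ξ' => iteratedFDeriv ℝ β (fun x' => a x' ξ') x) ξ‖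
      ≤ c * (1 + ‖ξ‖) ^ (m - (α : ℝ) + (β : ℝ))

/-- The pseudo-differential operator `T_a f(x) = ∫ a(x,ξ) f̂(ξ) e^{2πi⟨x,ξ⟩} dξ`
acting on a Schwartz function `f`. -/
def pdo {d : ℕ} (a : RD d → RD d → ℂ) (f : 𝓢(RD d, ℂ)) (x : RD d) : ℂ :=
  ∫ ξ, a x ξ * fourierS f ξ * Complex.exp (2 * Real.pi * Complex.I * ((⟪x, ξ⟫ : ℝ) : ℂ))

/-- Littlewood–Paley data: a Schwartz function `φ` with `φ̂` supported in
`{1/2 ≤ |ξ| ≤ 2}` and `Σ_{k∈ℤ} φ̂(2^{-k}ξ) = 1` for `ξ ≠ 0`, together with the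
low-frequency piece `Φ` determined by `Φ̂ = 1 - Σ_{k≥1} φ̂(2^{-k}·)`. -/
structure LPData (d : ℕ) where
  φ : 𝓢(RD d, ℂ)
  Φ : 𝓢(RD d, ℂ)
  supp_φ : ∀ ξ : RD d, fourierS φ ξ ≠ 0 → 1/2 ≤ ‖ξ‖ ∧ ‖ξ‖ ≤ 2
  sum_φ : ∀ ξ : RD d, ξ ≠ 0 → HasSum (fun k : ℤ => fourierS φ ((2:ℝ)^(-k) • ξ)) 1
  Φ_def : ∀ ξ : RD d, fourierS Φ ξ = 1 - ∑' k : ℕ, fourierS φ (((2:ℝ)^(k+1))⁻¹ • ξ)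

/-- The Littlewood–Paley convolution kernel: `Φ` for `k = 0` and
`φ_k = 2^{kd} φ(2^k ·)` for `k ≥ 1`. -/
def LPkernel {d : ℕ} (D : LPData d) : ℕ → RD d → ℂ
  | 0, x => D.Φ x
  | (k+1), x => (((2:ℝ)^((k+1) * d) : ℝ) : ℂ) * D.φ ((2:ℝ)^(k+1) • x)

/-- The Fourier transform of the `k`-th Littlewood–Paley kernel, i.e. `φ̂_k = φ̂(2^{-k}·)`
for `k ≥ 1` and `Φ̂` for `k = 0`. -/
def LPhat {d : ℕ} (D : LPData d) : ℕ → RD d → ℂ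
  | 0, ξ => fourierS D.Φ ξ
  | (k+1), ξ => fourierS D.φ (((2:ℝ)^(k+1))⁻¹ • ξ)

/-- Littlewood–Paley operator `Π_k g = φ_k ∗ g` (with `φ_0 := Φ`) acting on functions. -/
def LP {d : ℕ} (D : LPData d) (k : ℕ) (g : RD d → ℂ) (x : RD d) : ℂ :=
  ∫ y, LPkernel D k y * g (x - y)

/-- `Π*_k = Π_{k-1} + Π_k + Π_{k+1}` (with the convention `φ_{-1} := 0`). -/
def LPstar {d : ℕ} (D : LPData d) (k : ℕ) (g : RD d → ℂ) (x : RD d) : ℂ :=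
  (if k = 0 then 0 else LP D (k-1) g x) + LP D k g x + LP D (k+1) g x

open Classical in
/-- Pairing of a tempered distribution with a plain function: it gives `u ψ` if the
function is (the coercion of) a Schwartz function `ψ`, and `0` otherwise. -/
def pairing {d : ℕ} (u : TD d) (g : RD d → ℂ) : ℂ :=
  if h : ∃ ψ : 𝓢(RD d, ℂ), ⇑ψ = g then u h.choose else 0

/-- Fourier transform of a tempered distribution, `⟨û, ψ⟩ = ⟨u, ψ̂⟩`. -/
def fourierTD {d : ℕ} (u : TD d) : TD d :=
  u.comp (SchwartzMap.fourierTransformCLM ℂ)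

/-- Littlewood–Paley operator on tempered distributions:
`Π_k u (x) = ⟨u, φ_k(x - ·)⟩`. -/
def LPdist {d : ℕ} (D : LPData d) (k : ℕ) (u : TD d) (x : RD d) : ℂ :=
  pairing u (fun y => LPkernel D k (x - y))

/-- The symbol `a_{j,k}(x,ξ) = (φ_j ∗ a(·,ξ))(x) · φ̂_k(ξ)` (with `Φ` replacing `φ_0`). -/
def symbolPiece {d : ℕ} (D : LPData d) (a : RD d → RD d → ℂ) (j k : ℕ)
    (x ξ : RD d) : ℂ :=
  (∫ y, LPkernel D j y * a (x - y) ξ) * LPhat D k ξ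

/-- `T_{a_{j,k}} u (x) = ⟨û, a_{j,k}(x,·) e^{2πi⟨x,·⟩}⟩` for a tempered distribution `u`. -/
def pdoPieceD {d : ℕ} (D : LPData d) (a : RD d → RD d → ℂ) (j k : ℕ)
    (u : TD d) (x : RD d) : ℂ :=
  pairing (fourierTD u)
    (fun ξ => symbolPiece D a j k x ξ * Complex.exp (2 * Real.pi * Complex.I * ((⟪x, ξ⟫ : ℝ) : ℂ)))

/-- Partial sums `Σ_{j=0}^N Σ_{k=0}^N T_{a_{j,k}} u (x)`. -/
def pdoPartial {d : ℕ} (D : LPData d) (a : RD d → RD d → ℂ) (N : ℕ)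
    (u : TD d) (x : RD d) : ℂ :=
  ∑ j ∈ Finset.range (N+1), ∑ k ∈ Finset.range (N+1), pdoPieceD D a j k u x

/-- `T_a u` converges in `S'` to the tempered distribution `Tf`: the partial sums
`Σ_{j,k≤N} T_{a_{j,k}} u` (which are functions) converge to `Tf` weakly. -/
def ConvergesInSPrime {d : ℕ} (D : LPData d) (a : RD d → RD d → ℂ)
    (u : TD d) (Tf : TD d) : Prop :=
  ∀ ψ : 𝓢(RD d, ℂ),
    Tendsto (fun N => ∫ x, pdoPartial D a N u x * ψ x) atTop (nhds (Tf ψ))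

/-- The dyadic cube of level `ν` (side length `2^{-ν}`) indexed by `n ∈ ℤ^d`. -/
def dyadicCube (d : ℕ) (ν : ℤ) (n : Fin d → ℤ) : Set (RD d) :=
  {x | ∀ i, (n i : ℝ) * (2:ℝ)^(-ν) ≤ x i ∧ x i < ((n i : ℝ) + 1) * (2:ℝ)^(-ν)}

/-- The local quantity `(|P|⁻¹ ∫_P Σ_{k=k₀}^∞ 2^{skq} ‖g_k(x)‖^q dx)^{1/q}` for the
dyadic cube `P` of level `μ` indexed by `n` (so that `|P|⁻¹ = 2^{μd}`). -/
def cubePiece (d : ℕ) (μ : ℕ) (n : Fin d → ℤ) (k₀ : ℕ) (s q : ℝ)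
    (g : ℕ → RD d → ℂ) : ℝ≥0∞ :=
  ((2:ℝ≥0∞)^((μ:ℝ)*(d:ℝ)) *
    ∫⁻ x in dyadicCube d μ n,
      ∑' j : ℕ, (2:ℝ≥0∞)^(s*((k₀:ℝ)+(j:ℝ))*q) * (‖g (k₀+j) x‖₊ : ℝ≥0∞)^q) ^ (1/q)

/-- The `F_∞^{s,q}` norm (for `q < ∞`) of a function, computed from its
Littlewood–Paley pieces:
`‖Π_0 g‖_∞ + sup_{l(P)<1 dyadic} (|P|⁻¹ ∫_P Σ_{k=-log₂ l(P)}^∞ 2^{skq}|Π_k g|^q)^{1/q}`. -/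
def FinftyNormFun {d : ℕ} (D : LPData d) (s q : ℝ) (g : RD d → ℂ) : ℝ≥0∞ :=
  (⨆ x : RD d, (‖LP D 0 g x‖₊ : ℝ≥0∞)) +
  ⨆ (μ : ℕ) (_ : 1 ≤ μ) (n : Fin d → ℤ),
    cubePiece d μ n μ s q (fun k x => LP D k g x)

/-- The `F_∞^{s,q}` norm (for `q < ∞`) of a tempered distribution. -/
def FinftyNormDist {d : ℕ} (D : LPData d) (s q : ℝ) (u : TD d) : ℝ≥0∞ :=
  (⨆ x : RD d, (‖LPdist D 0 u x‖₊ : ℝ≥0∞)) +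
  ⨆ (μ : ℕ) (_ : 1 ≤ μ) (n : Fin d → ℤ),
    cubePiece d μ n μ s q (fun k x => LPdist D k u x)

/-- The (axis-parallel, closed) cube with corner `c` and side length `L`. -/
def cube (d : ℕ) (c : RD d) (L : ℝ) : Set (RD d) :=
  {x | ∀ i, c i ≤ x i ∧ x i ≤ c i + L}

/-- The average of `g` over the cube with corner `c` and side length `L`. -/
def cubeMean {d : ℕ} (c : RD d) (L : ℝ) (g : RD d → ℂ) : ℂ :=
  (L^d)⁻¹ • ∫ x in cube d c L, g x

/-- The `bmo` norm (local BMO):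
`sup_{l(Q)≥1} |Q|⁻¹∫_Q |g| + sup_{l(Q)<1} |Q|⁻¹∫_Q |g - g_Q|`, over all cubes `Q`. -/
def bmoNorm (d : ℕ) (g : RD d → ℂ) : ℝ≥0∞ :=
  (⨆ (c : RD d) (L : ℝ) (_ : 1 ≤ L),
    ENNReal.ofReal ((L^d)⁻¹) * ∫⁻ x in cube d c L, (‖g x‖₊ : ℝ≥0∞)) +
  (⨆ (c : RD d) (L : ℝ) (_ : 0 < L) (_ : L < 1),
    ENNReal.ofReal ((L^d)⁻¹) * ∫⁻ x in cube d c L, (‖g x - cubeMean c L g‖₊ : ℝ≥0∞))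

/-- The Peetre maximal function `𝔐_{σ,R} g(x) = sup_y ‖g(x-y)‖/(1+R‖y‖)^σ`. -/
def peetre {d : ℕ} (σ R : ℝ) (g : RD d → ℂ) (x : RD d) : ℝ≥0∞ :=
  ⨆ y : RD d, (‖g (x - y)‖₊ : ℝ≥0∞) / ENNReal.ofReal ((1 + R * ‖y‖) ^ σ)

/-- `g` has (distributional) Fourier support contained in `K`: the pairing
`⟨ĝ, ψ⟩ = ∫ g · ψ̂` vanishes for every Schwartz `ψ` whose support does not meet `K`. -/
def HasFourierSupportIn {d : ℕ} (g : RD d → ℂ) (K : Set (RD d)) : Prop :=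
  ∀ ψ : 𝓢(RD d, ℂ), tsupport ⇑ψ ∩ K = ∅ → ∫ x, g x * fourierS ψ x = 0

open FourierTransform in
lemma SchwartzMap.apply_eq_integral_fourierS {d : ℕ} (f : 𝓢(RD d, ℂ)) (y : RD d) :
    f y = ∫ v, Real.fourierChar (inner ℝ v y) • fourierS f v := by
  have h : 𝓕⁻ (𝓕 f) = f := FourierTransform.fourierInv_fourier_eq f
  conv_lhs => rw [← h]
  rw [fourierInv_coe, Real.fourierInv_eq]
  rfl

open FourierTransform in
/-- A function with Fourier support in `K`, dilated by `a` and localised by a Schwartz function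
`χ` whose transform lives in `E`, has no frequency `ξ` unless `ξ + a ζ ∈ E` for some `ζ ∈ K`. -/
lemma HasFourierSupportIn.fourier_mul_comp_eq_zero {d : ℕ} {F : RD d → ℂ} {K E : Set (RD d)}
    (hF : HasFourierSupportIn F K) (χ : 𝓢(RD d, ℂ)) (hE : IsClosed E)
    (hχ : ∀ ζ, fourierS χ ζ ≠ 0 → ζ ∈ E) {a : ℝ} (ha : 0 < a) (x ξ : RD d)
    (hξ : ∀ ζ ∈ K, ξ + a • ζ ∉ E) :
    𝓕 (fun y => χ y * F (x - a • y)) ξ = 0 := by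
  set e : RD d ≃L[ℝ] RD d := ContinuousLinearEquiv.smulLeft (Units.mk0 a ha.ne') with he
  have hea : ∀ ζ, e ζ = a • ζ := fun ζ => rfl
  set κ : 𝓢(RD d, ℂ) := compCLMOfContinuousLinearEquiv ℂ e (compSubConstCLM ℂ (-ξ) (fourierS χ))
    with hκdef
  have hκ : ∀ ζ, κ ζ = fourierS χ (ξ + a • ζ) := by
    intro ζ
    simp [hκdef, hea, add_comm]
  set ψ : 𝓢(RD d, ℂ) := 𝓕⁻ (compSubConstCLM ℂ x (𝓕 κ)) with hψdef
  have hψ : ∀ ζ, κ ζ = 0 → ψ ζ = 0 := by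
    intro ζ hζ
    have h1 : ψ ζ = ∫ z, Real.fourierChar (inner ℝ z ζ) • fourierS κ (z - x) := by
      rw [hψdef, fourierInv_coe, Real.fourierInv_eq]
      rfl
    rw [h1, ← integral_add_right_eq_self _ x]
    rw [κ.apply_eq_integral_fourierS] at hζ
    simp only [add_sub_cancel_right, inner_add_left, AddChar.map_add_eq_mul]
    simp_rw [mul_comm (Real.fourierChar _) (Real.fourierChar (inner ℝ x ζ)), mul_smul]
    simp_rw [Circle.smul_def] at hζ ⊢
    rw [integral_smul, hζ, smul_zero]
  have hts : tsupport ⇑ψ ∩ K = ∅ := by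
    have hcl : IsClosed {ζ : RD d | ξ + a • ζ ∈ E} := hE.preimage (by fun_prop)
    have hsub : tsupport ⇑ψ ⊆ {ζ : RD d | ξ + a • ζ ∈ E} := by
      refine closure_minimal (fun ζ hζ => ?_) hcl
      refine hχ _ ?_
      rw [← hκ]
      exact fun h => hζ (hψ ζ h)
    ext ζ
    simp only [Set.mem_inter_iff, Set.mem_empty_iff_false, iff_false, not_and]
    exact fun h1 h2 => hξ ζ h2 (hsub h1)
  have hzero := hF ψ hts
  have hFψ : ∀ z, fourierS ψ z = (𝓕 κ) (z - x) := by
    intro z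
    have : fourierS ψ = 𝓕 ψ := rfl
    rw [this, hψdef, FourierTransform.fourier_fourierInv_eq]
    rfl
  have hFκ : ∀ y, (𝓕 κ) (-(a • y)) =
      (a ^ d)⁻¹ • (Real.fourierChar (-inner ℝ y ξ) • χ y) := by
    intro y
    rw [fourier_coe, Real.fourier_eq, χ.apply_eq_integral_fourierS]
    set G : RD d → ℂ := fun v => Real.fourierChar (inner ℝ (v - ξ) y) • fourierS χ v with hG
    have h3 : ∀ ζ : RD d, Real.fourierChar (-inner ℝ ζ (-(a • y))) • κ ζ = G (ξ + a • ζ) := by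
      intro ζ
      simp [hG, hκ, inner_smul_left, inner_smul_right]
    rw [integral_congr_ae (.of_forall h3)]
    refine (Measure.integral_comp_smul_of_nonneg volume
      (fun w => G (ξ + w)) a (hR := ha.le)).trans ?_
    rw [integral_add_left_eq_self]
    simp only [hG, finrank_euclideanSpace, Fintype.card_fin]
    congr 1
    have h5 : ∀ v, Real.fourierChar (inner ℝ (v - ξ) y) • fourierS χ v =
        (Real.fourierChar (-inner ℝ y ξ) : ℂ) •
          (Real.fourierChar (inner ℝ v y) • fourierS χ v) := by
      intro v
      rw [inner_sub_left, sub_eq_neg_add, AddChar.map_add_eq_mul, real_inner_comm, mul_smul]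
      rfl
    simp_rw [h5]
    rw [integral_smul]
    rfl
  simp_rw [hFψ] at hzero
  rw [← integral_add_right_eq_self _ x, ← integral_neg_eq_self] at hzero
  have hsc := Measure.integral_comp_smul_of_nonneg (volume : Measure (RD d))
    (fun z => F (-z + x) * (𝓕 κ) (-z + x - x)) a (hR := ha.le)
  rw [hzero, smul_zero] at hsc
  simp only [add_sub_cancel_right, hFκ] at hsc
  have h4 : ∀ y, F (-(a • y) + x) * ((a ^ d)⁻¹ • (Real.fourierChar (-inner ℝ y ξ) • χ y)) =
      (a ^ d)⁻¹ • (Real.fourierChar (-inner ℝ y ξ) • (χ y * F (x - a • y))) := by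
    intro y
    rw [sub_eq_neg_add]
    simp only [Circle.smul_def, smul_eq_mul, Complex.real_smul]
    ring
  simp_rw [h4] at hsc
  rw [integral_smul] at hsc
  rw [Real.fourier_eq]
  exact (smul_eq_zero.mp hsc).resolve_left (by positivity)

open FourierTransform in
/-- A function with frequencies in a ball of radius `ρ` is bounded by its `L¹` norm times the
volume of that ball. -/
lemma enorm_le_volume_mul_lintegral_of_fourier_eq_zero {d : ℕ} {g : RD d → ℂ}
    (hgc : Continuous g) (hgi : Integrable g) {ρ : ℝ} (hg : ∀ ξ, ρ < ‖ξ‖ → 𝓕 g ξ = 0)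
    (y : RD d) :
    ‖g y‖ₑ ≤ volume (Metric.closedBall (0 : RD d) ρ) * ∫⁻ z, ‖g z‖ₑ := by
  have hcont : Continuous (𝓕 g) :=
    VectorFourier.fourierIntegral_continuous Real.continuous_fourierChar continuous_inner hgi
  have hcs : HasCompactSupport (𝓕 g) := by
    refine HasCompactSupport.intro (isCompact_closedBall (0 : RD d) ρ) fun ξ hξ => hg ξ ?_
    simpa using hξ
  have hint : Integrable (𝓕 g) := hcont.integrable_of_hasCompactSupport hcs
  have hbound : ∀ ξ, ‖𝓕 g ξ‖ₑ ≤ ∫⁻ z, ‖g z‖ₑ := by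
    intro ξ
    rw [Real.fourier_eq]
    refine (enorm_integral_le_lintegral_enorm _).trans (le_of_eq ?_)
    refine lintegral_congr fun z => ?_
    rw [← ofReal_norm, ← ofReal_norm, Circle.norm_smul]
  calc ‖g y‖ₑ = ‖𝓕⁻ (𝓕 g) y‖ₑ := by rw [hgc.fourierInv_fourier_eq hgi hint]
    _ ≤ ∫⁻ ξ, ‖𝓕 g ξ‖ₑ := by
      rw [Real.fourierInv_eq]
      refine (enorm_integral_le_lintegral_enorm _).trans (le_of_eq ?_)
      refine lintegral_congr fun z => ?_
      rw [← ofReal_norm, ← ofReal_norm, Circle.norm_smul]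
    _ ≤ ∫⁻ ξ, (Metric.closedBall (0 : RD d) ρ).indicator (fun _ => ∫⁻ z, ‖g z‖ₑ) ξ := by
      refine lintegral_mono fun ξ => ?_
      by_cases h : ξ ∈ Metric.closedBall (0 : RD d) ρ
      · simpa [Set.indicator_of_mem h] using hbound ξ
      · simp only [hg ξ (by simpa using h), enorm_zero, zero_le]
    _ = volume (Metric.closedBall (0 : RD d) ρ) * ∫⁻ z, ‖g z‖ₑ := by
      rw [lintegral_indicator_const Metric.isClosed_closedBall.measurableSet, mul_comm]

open FourierTransform in
/-- Nikol'skii's inequality between `L¹` and `L^q`, `q ≤ 1`. -/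
lemma lintegral_enorm_rpow_le_of_fourier_eq_zero {d : ℕ} {g : RD d → ℂ}
    (hgc : Continuous g) (hgi : Integrable g) {ρ : ℝ} (hg : ∀ ξ, ρ < ‖ξ‖ → 𝓕 g ξ = 0)
    {q : ℝ} (hq : 0 < q) (hq1 : q ≤ 1) :
    (∫⁻ z, ‖g z‖ₑ) ^ q ≤
      volume (Metric.closedBall (0 : RD d) ρ) ^ (1 - q) * ∫⁻ z, ‖g z‖ₑ ^ q := by
  set I := ∫⁻ z, ‖g z‖ₑ with hI
  set V := volume (Metric.closedBall (0 : RD d) ρ) with hV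
  have hItop : I ≠ ⊤ := hgi.2.ne
  rcases eq_or_ne I 0 with h0 | h0
  · simp [h0, ENNReal.zero_rpow_of_pos hq]
  have hle : I ≤ (V * I) ^ (1 - q) * ∫⁻ z, ‖g z‖ₑ ^ q := by
    rw [← lintegral_const_mul _ (by fun_prop)]
    refine lintegral_mono fun z => ?_
    calc ‖g z‖ₑ = ‖g z‖ₑ ^ (1 - q) * ‖g z‖ₑ ^ q := by
          rw [← ENNReal.rpow_add_of_nonneg _ _ (by linarith) hq.le]; simp
      _ ≤ _ := by
          gcongr
          exact enorm_le_volume_mul_lintegral_of_fourier_eq_zero hgc hgi hg z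
  have hIq : I ^ (1 - q) ≠ 0 := by simp [h0, hItop]
  have hIq' : I ^ (1 - q) ≠ ⊤ := ENNReal.rpow_ne_top_of_nonneg (by linarith) hItop
  refine (ENNReal.mul_le_mul_iff_right hIq hIq').mp ?_
  calc I ^ (1 - q) * I ^ q = I := by
        rw [← ENNReal.rpow_add_of_nonneg _ _ (by linarith) hq.le]; simp
    _ ≤ _ := hle
    _ = _ := by rw [ENNReal.mul_rpow_of_nonneg _ _ (by linarith)]; ring

/-- Jensen's inequality with respect to a weight of arbitrary mass. -/
lemma lintegral_mul_rpow_le {α : Type*} [MeasurableSpace α] {μ : Measure α}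
    {w f : α → ℝ≥0∞} (hw : Measurable w) (hf : Measurable f) {q : ℝ} (hq : 1 ≤ q) :
    (∫⁻ a, w a * f a ∂μ) ^ q ≤ (∫⁻ a, w a ∂μ) ^ (q - 1) * ∫⁻ a, w a * f a ^ q ∂μ := by
  have hq0 : 0 < q := by linarith
  have hqi : q⁻¹ ≤ 1 := inv_le_one_of_one_le₀ hq
  have hqi0 : 0 ≤ q⁻¹ := by positivity
  have h := ENNReal.lintegral_mul_norm_pow_le (μ := μ) (f := w) (g := fun a => w a * f a ^ q)
    hw.aemeasurable (by fun_prop) (p := 1 - q⁻¹) (q := q⁻¹) (by linarith) hqi0 (by ring)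
  have h1 : ∀ a, w a ^ (1 - q⁻¹) * (w a * f a ^ q) ^ q⁻¹ = w a * f a := by
    intro a
    rw [ENNReal.mul_rpow_of_nonneg _ _ hqi0, ← ENNReal.rpow_mul, mul_inv_cancel₀ hq0.ne',
      ENNReal.rpow_one, ← mul_assoc, ← ENNReal.rpow_add_of_nonneg _ _ (by linarith) hqi0]
    simp
  simp_rw [h1] at h
  refine (ENNReal.rpow_le_rpow h hq0.le).trans (le_of_eq ?_)
  rw [ENNReal.mul_rpow_of_nonneg _ _ hq0.le, ← ENNReal.rpow_mul, ← ENNReal.rpow_mul,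
    inv_mul_cancel₀ hq0.ne', ENNReal.rpow_one, sub_mul, inv_mul_cancel₀ hq0.ne', one_mul]

/-- Jensen's inequality for series with respect to weights of arbitrary mass. -/
lemma tsum_mul_rpow_le {w f : ℕ → ℝ≥0∞} {q : ℝ} (hq : 1 ≤ q) :
    (∑' i, w i * f i) ^ q ≤ (∑' i, w i) ^ (q - 1) * ∑' i, w i * f i ^ q := by
  simpa [lintegral_count] using lintegral_mul_rpow_le (μ := Measure.count)
    (measurable_of_countable w) (measurable_of_countable f) hq

/-- Subadditivity of `t ↦ t ^ q`, `0 < q ≤ 1`, for series. -/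
lemma tsum_rpow_le {f : ℕ → ℝ≥0∞} {q : ℝ} (hq : 0 < q) (hq1 : q ≤ 1) :
    (∑' i, f i) ^ q ≤ ∑' i, f i ^ q := by
  have hfin : ∀ t : Finset ℕ, (∑ i ∈ t, f i) ^ q ≤ ∑ i ∈ t, f i ^ q := by
    intro t
    induction t using Finset.induction_on with
    | empty => simp [hq]
    | insert a t ha ih =>
      rw [Finset.sum_insert ha, Finset.sum_insert ha]
      exact (ENNReal.rpow_add_le_add_rpow _ _ hq.le hq1).trans (by gcongr)
  have h1 : Tendsto (fun t : Finset ℕ => (∑ i ∈ t, f i) ^ q) atTop (nhds ((∑' i, f i) ^ q)) :=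
    (ENNReal.continuous_rpow_const.tendsto _).comp ENNReal.summable.hasSum
  exact le_of_tendsto h1 (.of_forall fun t => (hfin t).trans (ENNReal.sum_le_tsum t))

/-- The weight `(1 + ‖y‖) ^ (-M)`. -/
def decayWeight {d : ℕ} (M : ℝ) (y : RD d) : ℝ≥0∞ := ENNReal.ofReal ((1 + ‖y‖) ^ (-M))

@[fun_prop]
lemma measurable_decayWeight {d : ℕ} (M : ℝ) : Measurable (decayWeight (d := d) M) := by
  unfold decayWeight
  fun_prop

lemma SchwartzMap.exists_enorm_rpow_le_decayWeight {d : ℕ} (χ : 𝓢(RD d, ℂ)) {q : ℝ} (hq : 0 < q)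
    (M : ℝ) : ∃ C : ℝ≥0, ∀ y, ‖χ y‖ₑ ^ q ≤ C * decayWeight M y := by
  obtain ⟨k, hk⟩ := exists_nat_ge (M / q)
  rw [div_le_iff₀ hq] at hk
  set B : ℝ := 2 ^ k * (Finset.Iic ((k, 0) : ℕ × ℕ)).sup
    (fun m => SchwartzMap.seminorm ℝ m.1 m.2) χ
  have hB : ∀ y, (1 + ‖y‖) ^ k * ‖χ y‖ ≤ B := by
    intro y
    simpa using one_add_le_sup_seminorm_apply (𝕜 := ℝ) (m := (k, 0)) (k := k) (n := 0)
      le_rfl le_rfl χ y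
  refine ⟨(B ^ q).toNNReal, fun y => ?_⟩
  have hpos : 0 < 1 + ‖y‖ := by positivity
  have hB0 : 0 ≤ B := le_trans (by positivity) (hB y)
  have h1 : ‖χ y‖ ^ q ≤ B ^ q * (1 + ‖y‖) ^ (-M) := by
    have h2 : ((1 + ‖y‖) ^ k * ‖χ y‖) ^ q ≤ B ^ q :=
      Real.rpow_le_rpow (by positivity) (hB y) hq.le
    rw [Real.mul_rpow (by positivity) (by positivity), ← Real.rpow_natCast,
      ← Real.rpow_mul hpos.le] at h2
    have h3 : (1 + ‖y‖) ^ M ≤ (1 + ‖y‖) ^ ((k : ℝ) * q) :=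
      Real.rpow_le_rpow_of_exponent_le (by linarith [norm_nonneg y]) hk
    rw [Real.rpow_neg hpos.le, ← div_eq_mul_inv, le_div_iff₀ (by positivity), mul_comm]
    exact le_trans (by gcongr) h2
  rw [decayWeight, ← ofReal_norm, ENNReal.ofReal_rpow_of_nonneg (norm_nonneg _) hq.le]
  change _ ≤ ENNReal.ofReal (B ^ q) * _
  rw [← ENNReal.ofReal_mul (by positivity)]
  exact ENNReal.ofReal_le_ofReal h1

lemma LP_eq_integral {d : ℕ} (D : LPData d) {l : ℕ} (hl : 1 ≤ l) (g : RD d → ℂ) (x : RD d) :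
    LP D l g x = ∫ y, D.φ y * g (x - ((2 : ℝ) ^ l)⁻¹ • y) := by
  obtain ⟨l, rfl⟩ : ∃ l', l = l' + 1 := ⟨l - 1, by omega⟩
  have h := Measure.integral_comp_smul_of_nonneg (volume : Measure (RD d))
    (fun y => D.φ y * g (x - ((2 : ℝ) ^ (l + 1))⁻¹ • y)) ((2 : ℝ) ^ (l + 1))
    (hR := by positivity)
  rw [finrank_euclideanSpace, Fintype.card_fin, ← pow_mul] at h
  have h2 : ∀ y : RD d, ((2 : ℝ) ^ (l + 1))⁻¹ • ((2 : ℝ) ^ (l + 1)) • y = y := fun y =>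
    inv_smul_smul₀ (by positivity) y
  simp only [h2] at h
  unfold LP LPkernel
  simp_rw [mul_assoc]
  rw [integral_const_mul, h, Complex.real_smul, ← mul_assoc, ← Complex.ofReal_mul,
    mul_inv_cancel₀ (by positivity)]
  simp

lemma Function.HasTemperateGrowth.continuous_mul_comp {d : ℕ} {F : RD d → ℂ}
    (hF : F.HasTemperateGrowth) (χ : 𝓢(RD d, ℂ)) (a : ℝ) (x : RD d) :
    Continuous fun y => χ y * F (x - a • y) := by
  have := hF.1.continuous
  have := χ.continuous
  fun_prop

lemma Function.HasTemperateGrowth.integrable_mul_comp {d : ℕ} {F : RD d → ℂ}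
    (hF : F.HasTemperateGrowth) (χ : 𝓢(RD d, ℂ)) (a : ℝ) (x : RD d) :
    Integrable fun y => χ y * F (x - a • y) := by
  have h : Function.HasTemperateGrowth fun y => F (x - a • y) :=
    hF.comp (f := fun y => x - a • y) (by fun_prop)
  refine (smulLeftCLM ℂ (fun y => F (x - a • y)) χ).integrable.congr (.of_forall fun y => ?_)
  simp only [smulLeftCLM_apply_apply h, smul_eq_mul, mul_comm]

lemma isClosed_annulus {d : ℕ} : IsClosed {ξ : RD d | 1 / 2 ≤ ‖ξ‖ ∧ ‖ξ‖ ≤ 2} :=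
  (isClosed_le continuous_const continuous_norm).inter
    (isClosed_le continuous_norm continuous_const)

open FourierTransform in
/-- `Π_l` annihilates functions with frequencies well below `2 ^ l`. -/
lemma LP_eq_zero_of_lt {d : ℕ} (D : LPData d) {A : ℝ} {h k l : ℕ} (hAh : A < 2 ^ h)
    (hkl : k + h < l) {F : RD d → ℂ}
    (hF : HasFourierSupportIn F {ξ : RD d | ‖ξ‖ ≤ A * (2 : ℝ) ^ k}) (x : RD d) :
    LP D l F x = 0 := by
  have h0 := hF.fourier_mul_comp_eq_zero D.φ isClosed_annulus D.supp_φ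
    (a := ((2 : ℝ) ^ l)⁻¹) (by positivity) x 0 ?_
  · rw [LP_eq_integral D (by omega)]
    simpa [Real.fourier_eq] using h0
  · rintro ζ hζ ⟨h1, -⟩
    rw [zero_add, norm_smul, Real.norm_of_nonneg (by positivity), inv_mul_eq_div,
      le_div_iff₀ (by positivity)] at h1
    obtain ⟨m, rfl⟩ : ∃ m, l = k + h + 1 + m := ⟨l - (k + h + 1), by omega⟩
    have h2 : (1 : ℝ) ≤ 2 ^ m := one_le_pow₀ (by norm_num)
    have h3 : (0 : ℝ) < 2 ^ k := by positivity
    have h4 : (0 : ℝ) < 2 ^ h := by positivity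
    have hζ' : ‖ζ‖ ≤ A * 2 ^ k := hζ
    rw [pow_add, pow_add, pow_add] at h1
    have h5 : A * 2 ^ k < 2 ^ k * 2 ^ h := by
      rw [mul_comm]; gcongr
    have h6 : (2 : ℝ) ^ k * 2 ^ h ≤ 2 ^ k * 2 ^ h * 2 ^ m :=
      le_mul_of_one_le_right (by positivity) h2
    linarith

/-- Integral form of the estimate for `Π_l F`, without frequency localisation. -/
lemma enorm_LP_le {d : ℕ} (D : LPData d) {l : ℕ} (hl : 1 ≤ l) (F : RD d → ℂ) (x : RD d) :
    ‖LP D l F x‖ₑ ≤ ∫⁻ y, ‖D.φ y * F (x - ((2 : ℝ) ^ l)⁻¹ • y)‖ₑ := by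
  rw [LP_eq_integral D hl]
  exact enorm_integral_le_lintegral_enorm _

open FourierTransform in
lemma exists_enorm_LP_rpow_le_of_le_one {d : ℕ} (D : LPData d) {A : ℝ} (hA : 1 < A) (h : ℕ)
    {q : ℝ} (hq : 0 < q) (hq1 : q ≤ 1) (M : ℝ) :
    ∃ C : ℝ≥0, ∀ (l k m : ℕ), 1 ≤ l → k + h = l + m → ∀ F : RD d → ℂ, F.HasTemperateGrowth →
      HasFourierSupportIn F {ξ : RD d | ‖ξ‖ ≤ A * (2 : ℝ) ^ k} → ∀ x,
      ‖LP D l F x‖ₑ ^ q ≤ C * (2 : ℝ≥0∞) ^ (d * (1 - q) * m) *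
        ∫⁻ y, decayWeight M y * ‖F (x - ((2 : ℝ) ^ l)⁻¹ • y)‖ₑ ^ q := by
  obtain ⟨C₁, hC₁⟩ := D.φ.exists_enorm_rpow_le_decayWeight hq M
  set V := volume (Metric.closedBall (0 : RD d) (2 + A)) with hV
  have hVtop : V ^ (1 - q) ≠ ⊤ :=
    ENNReal.rpow_ne_top_of_nonneg (by linarith) measure_closedBall_lt_top.ne
  refine ⟨(V ^ (1 - q)).toNNReal * C₁, fun l k m hl hm F hF hFs x => ?_⟩
  set a : ℝ := ((2 : ℝ) ^ l)⁻¹ with ha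
  have hapos : 0 < a := by positivity
  have hak : a * 2 ^ k ≤ 2 ^ m := by
    rw [ha, inv_mul_le_iff₀ (by positivity), ← pow_add, ← hm]
    exact pow_le_pow_right₀ (by norm_num) (by omega)
  have hsupp : ∀ ξ, (2 + A) * 2 ^ m < ‖ξ‖ → 𝓕 (fun y => D.φ y * F (x - a • y)) ξ = 0 := by
    intro ξ hξ
    refine hFs.fourier_mul_comp_eq_zero D.φ isClosed_annulus D.supp_φ hapos x ξ ?_
    rintro ζ hζ ⟨-, h2⟩
    have hζ' : ‖ζ‖ ≤ A * 2 ^ k := hζ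
    have h3 : ‖ξ‖ ≤ ‖ξ + a • ζ‖ + ‖a • ζ‖ := by
      simpa using norm_sub_le (ξ + a • ζ) (a • ζ)
    rw [norm_smul, Real.norm_of_nonneg hapos.le] at h3
    have h4 : a * ‖ζ‖ ≤ A * 2 ^ m := by
      calc a * ‖ζ‖ ≤ a * (A * 2 ^ k) := by gcongr
        _ = A * (a * 2 ^ k) := by ring
        _ ≤ A * 2 ^ m := by gcongr
    have h5 : (1 : ℝ) ≤ 2 ^ m := one_le_pow₀ (by norm_num)
    linarith
  have hvol : volume (Metric.closedBall (0 : RD d) ((2 + A) * 2 ^ m)) ^ (1 - q) =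
      (2 : ℝ≥0∞) ^ (d * (1 - q) * m) * V ^ (1 - q) := by
    have h1 := Measure.addHaar_closedBall_mul (volume : Measure (RD d)) (0 : RD d)
      (r := 2 ^ m) (by positivity) (s := 2 + A)
    rw [mul_comm, h1 (by linarith), finrank_euclideanSpace, Fintype.card_fin,
      ENNReal.mul_rpow_of_nonneg _ _ (by linarith)]
    congr 1
    rw [ENNReal.ofReal_pow (by positivity), ENNReal.ofReal_pow (by positivity),
      ENNReal.ofReal_ofNat, ← ENNReal.rpow_natCast, ← ENNReal.rpow_natCast, ← ENNReal.rpow_mul,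
      ← ENNReal.rpow_mul]
    congr 1
    ring
  calc ‖LP D l F x‖ₑ ^ q
      ≤ (∫⁻ y, ‖D.φ y * F (x - a • y)‖ₑ) ^ q := by
        gcongr
        exact enorm_LP_le D hl F x
    _ ≤ (2 : ℝ≥0∞) ^ (d * (1 - q) * m) * V ^ (1 - q) *
          ∫⁻ y, ‖D.φ y * F (x - a • y)‖ₑ ^ q := by
        rw [← hvol]
        exact lintegral_enorm_rpow_le_of_fourier_eq_zero (hF.continuous_mul_comp D.φ a x)
          (hF.integrable_mul_comp D.φ a x) hsupp hq hq1
    _ ≤ (2 : ℝ≥0∞) ^ (d * (1 - q) * m) * V ^ (1 - q) *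
          ∫⁻ y, C₁ * (decayWeight M y * ‖F (x - a • y)‖ₑ ^ q) := by
        gcongr with y
        rw [enorm_mul, ENNReal.mul_rpow_of_nonneg _ _ hq.le, ← mul_assoc]
        gcongr
        exact hC₁ y
    _ = _ := by
        rw [lintegral_const_mul' _ _ ENNReal.coe_ne_top, ENNReal.coe_mul,
          ENNReal.coe_toNNReal hVtop]
        ring

lemma exists_enorm_LP_rpow_le_of_one_le {d : ℕ} (D : LPData d) {q : ℝ} (hq : 1 ≤ q) (M : ℝ) :
    ∃ C : ℝ≥0, ∀ l : ℕ, 1 ≤ l → ∀ F : RD d → ℂ, Continuous F → ∀ x,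
      ‖LP D l F x‖ₑ ^ q ≤ C * ∫⁻ y, decayWeight M y * ‖F (x - ((2 : ℝ) ^ l)⁻¹ • y)‖ₑ ^ q := by
  obtain ⟨C₁, hC₁⟩ := D.φ.exists_enorm_rpow_le_decayWeight one_pos M
  simp only [ENNReal.rpow_one] at hC₁
  have hφ : (∫⁻ y, ‖D.φ y‖ₑ) ^ (q - 1) ≠ ⊤ :=
    ENNReal.rpow_ne_top_of_nonneg (by linarith) D.φ.integrable.2.ne
  have hφc := D.φ.continuous
  refine ⟨((∫⁻ y, ‖D.φ y‖ₑ) ^ (q - 1)).toNNReal * C₁, fun l hl F hF x => ?_⟩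
  set a : ℝ := ((2 : ℝ) ^ l)⁻¹ with ha
  have hFm : Measurable fun y => ‖F (x - a • y)‖ₑ :=
    Continuous.measurable (by fun_prop)
  calc ‖LP D l F x‖ₑ ^ q
      ≤ (∫⁻ y, ‖D.φ y‖ₑ * ‖F (x - a • y)‖ₑ) ^ q := by
        simp_rw [← enorm_mul]
        exact ENNReal.rpow_le_rpow (enorm_LP_le D hl F x) (by linarith)
    _ ≤ (∫⁻ y, ‖D.φ y‖ₑ) ^ (q - 1) * ∫⁻ y, ‖D.φ y‖ₑ * ‖F (x - a • y)‖ₑ ^ q :=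
        lintegral_mul_rpow_le (by fun_prop) hFm hq
    _ ≤ (∫⁻ y, ‖D.φ y‖ₑ) ^ (q - 1) * ∫⁻ y, C₁ * (decayWeight M y * ‖F (x - a • y)‖ₑ ^ q) := by
        refine mul_le_mul_right (lintegral_mono fun y => ?_) _
        rw [← mul_assoc]
        gcongr
        exact hC₁ y
    _ = _ := by
        rw [lintegral_const_mul' _ _ ENNReal.coe_ne_top, ENNReal.coe_mul, ENNReal.coe_toNNReal hφ]
        ring

/-- Estimate of `Π_l F` by an average of `‖F‖ ^ q`, for `F` with frequencies at most `A 2 ^ k`. -/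
lemma exists_enorm_LP_rpow_le {d : ℕ} (D : LPData d) {A : ℝ} (hA : 1 < A) (h : ℕ)
    {q : ℝ} (hq : 0 < q) (M : ℝ) :
    ∃ C : ℝ≥0, ∀ (l k m : ℕ), 1 ≤ l → k + h = l + m → ∀ F : RD d → ℂ, F.HasTemperateGrowth →
      HasFourierSupportIn F {ξ : RD d | ‖ξ‖ ≤ A * (2 : ℝ) ^ k} → ∀ x,
      ‖LP D l F x‖ₑ ^ q ≤ C * (2 : ℝ≥0∞) ^ (d * (1 - min 1 q) * m) *
        ∫⁻ y, decayWeight M y * ‖F (x - ((2 : ℝ) ^ l)⁻¹ • y)‖ₑ ^ q := by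
  rcases le_total q 1 with hq1 | hq1
  · simpa only [min_eq_right hq1] using exists_enorm_LP_rpow_le_of_le_one D hA h hq hq1 M
  · obtain ⟨C, hC⟩ := exists_enorm_LP_rpow_le_of_one_le D hq1 M
    refine ⟨C, fun l k m hl _ F hF _ x => ?_⟩
    simpa [min_eq_left hq1] using hC l hl F hF.1.continuous x

lemma tsum_ite_pow_le {P : ℕ → Prop} [DecidablePred P] {e : ℕ → ℕ}
    (he : Set.InjOn e {k | P k}) (r : ℝ≥0∞) :
    ∑' k, (if P k then r ^ e k else 0) ≤ (1 - r)⁻¹ := by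
  calc ∑' k, (if P k then r ^ e k else 0)
      = ∑' k : {k | P k}, r ^ e k := by
        rw [tsum_subtype {k | P k} fun k => r ^ e k]
        simp only [Set.indicator_apply, Set.mem_ofPred_eq]
    _ ≤ ∑' m : ℕ, r ^ m :=
        ENNReal.tsum_comp_le_tsum_of_injective (Set.injOn_iff_injective.mp he) fun m => r ^ m
    _ = _ := ENNReal.tsum_geometric r

lemma two_rpow_mul_natCast (t : ℝ) (m : ℕ) : (2 : ℝ≥0∞) ^ (t * m) = (2 ^ t) ^ m := by
  rw [ENNReal.rpow_mul, ENNReal.rpow_natCast]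

lemma one_sub_two_rpow_neg_inv_ne_top {t : ℝ} (ht : 0 < t) :
    (1 - (2 : ℝ≥0∞) ^ (-t))⁻¹ ≠ ⊤ := by
  rw [ENNReal.inv_ne_top]
  refine (tsub_pos_of_lt ?_).ne'
  exact ENNReal.rpow_lt_one_of_one_lt_of_neg (by norm_num) (by linarith)

/-- The `q`-th power of a series starting at `k = l - h`, up to an exponential loss which can be
made arbitrarily small. -/
lemma exists_tsum_rpow_le {ε : ℝ} (hε : 0 < ε) {q : ℝ} (hq : 0 < q) (h : ℕ) :
    ∃ C : ℝ≥0, ∀ (l : ℕ) (b : ℕ → ℝ≥0∞), (∀ k, k + h < l → b k = 0) →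
      (∑' k, b k) ^ q ≤ C * ∑' k, (if l ≤ k + h then
        (2 : ℝ≥0∞) ^ (ε * (max 1 q - 1) * (k + h - l : ℕ)) * b k ^ q else 0) := by
  rcases le_total q 1 with hq1 | hq1
  · refine ⟨1, fun l b hb => ?_⟩
    rw [ENNReal.coe_one, one_mul]
    refine (tsum_rpow_le hq hq1).trans (ENNReal.tsum_le_tsum fun k => ?_)
    split_ifs with hk
    · simp [max_eq_left hq1]
    · simp [hb k (by omega), hq]
  · set S := (1 - (2 : ℝ≥0∞) ^ (-ε))⁻¹ with hS
    have hStop : S ^ (q - 1) ≠ ⊤ :=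
      ENNReal.rpow_ne_top_of_nonneg (by linarith) (one_sub_two_rpow_neg_inv_ne_top hε)
    refine ⟨(S ^ (q - 1)).toNNReal, fun l b hb => ?_⟩
    rw [ENNReal.coe_toNNReal hStop]
    set w : ℕ → ℝ≥0∞ := fun k => if l ≤ k + h then ((2 : ℝ≥0∞) ^ (-ε)) ^ (k + h - l) else 0
      with hw
    set f : ℕ → ℝ≥0∞ := fun k => (2 : ℝ≥0∞) ^ (ε * (k + h - l : ℕ)) * b k with hf
    have h2 : (2 : ℝ≥0∞) ≠ 0 := by norm_num
    have h2' : (2 : ℝ≥0∞) ≠ ⊤ := by norm_num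
    have hwf : ∀ k, w k * f k = b k := by
      intro k
      simp only [hw, hf]
      split_ifs with hk
      · rw [← two_rpow_mul_natCast, ← mul_assoc, ← ENNReal.rpow_add _ _ h2 h2']
        simp
      · simp [hb k (by omega)]
    have hwfq : ∀ k, w k * f k ^ q = if l ≤ k + h then
        (2 : ℝ≥0∞) ^ (ε * (max 1 q - 1) * (k + h - l : ℕ)) * b k ^ q else 0 := by
      intro k
      simp only [hw, hf]
      split_ifs with hk
      · rw [← two_rpow_mul_natCast, ENNReal.mul_rpow_of_nonneg _ _ hq.le, ← mul_assoc,
          ← ENNReal.rpow_mul, ← ENNReal.rpow_add _ _ h2 h2', max_eq_right hq1]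
        congr 2
        ring
      · simp
    have hwS : ∑' k, w k ≤ S := by
      refine tsum_ite_pow_le (e := fun k => k + h - l) (fun i hi j hj hij => ?_) _
      simp only [Set.mem_ofPred_eq] at hi hj hij
      omega
    have hmain := tsum_mul_rpow_le (w := w) (f := f) hq1
    simp_rw [hwf, hwfq] at hmain
    refine hmain.trans ?_
    gcongr

/-- Pointwise estimate for `Π_l (∑ F_k)`. -/
lemma exists_enorm_tsum_LP_rpow_le {d : ℕ} (D : LPData d) {A : ℝ} (hA : 1 < A) {h : ℕ}
    (hAh : A < 2 ^ h) {q : ℝ} (hq : 0 < q) {ε : ℝ} (hε : 0 < ε) (M : ℝ) :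
    ∃ C : ℝ≥0, ∀ l : ℕ, 1 ≤ l → ∀ F : ℕ → RD d → ℂ, (∀ k, (F k).HasTemperateGrowth) →
      (∀ k, HasFourierSupportIn (F k) {ξ : RD d | ‖ξ‖ ≤ A * (2 : ℝ) ^ k}) → ∀ x,
      ‖∑' k, LP D l (F k) x‖ₑ ^ q ≤ C * ∑' k, (if l ≤ k + h then
        (2 : ℝ≥0∞) ^ ((d * (1 - min 1 q) + ε * (max 1 q - 1)) * (k + h - l : ℕ)) *
          ∫⁻ y, decayWeight M y * ‖F k (x - ((2 : ℝ) ^ l)⁻¹ • y)‖ₑ ^ q else 0) := by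
  obtain ⟨C₁, hC₁⟩ := exists_tsum_rpow_le hε hq h
  obtain ⟨C₂, hC₂⟩ := exists_enorm_LP_rpow_le D hA h hq M
  refine ⟨C₁ * C₂, fun l hl F hF hFs x => ?_⟩
  refine (ENNReal.rpow_le_rpow enorm_tsum_le_tsum_enorm hq.le).trans ?_
  refine (hC₁ l _ fun k hk => ?_).trans ?_
  · rw [LP_eq_zero_of_lt D hAh hk (hFs k), enorm_zero]
  rw [ENNReal.coe_mul, mul_assoc, ← ENNReal.tsum_mul_left (a := (C₂ : ℝ≥0∞))]
  gcongr with k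
  split_ifs with hk
  · refine (mul_le_mul_right (hC₂ l k (k + h - l) hl (by omega) (F k) (hF k) (hFs k) x) _).trans
      (le_of_eq ?_)
    rw [add_mul, ENNReal.rpow_add _ _ (by norm_num) (by norm_num)]
    ring
  · simp

lemma decayWeight_le_mul {d : ℕ} {M c : ℝ} (hM : 0 ≤ M) (hc : 0 ≤ c) {y z : RD d}
    (h : 1 + ‖z‖ ≤ c * (1 + ‖y‖)) :
    decayWeight M y ≤ ENNReal.ofReal (c ^ M) * decayWeight M z := by
  rw [decayWeight, decayWeight, ← ENNReal.ofReal_mul (by positivity)]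
  refine ENNReal.ofReal_le_ofReal ?_
  have hy : 0 < 1 + ‖y‖ := by positivity
  have hz : 0 < 1 + ‖z‖ := by positivity
  have h1 := Real.rpow_le_rpow hz.le h hM
  rw [Real.mul_rpow hc hy.le] at h1
  rw [Real.rpow_neg hy.le, Real.rpow_neg hz.le, ← div_eq_mul_inv, le_div_iff₀ (by positivity),
    inv_mul_le_iff₀ (by positivity), mul_comm]
  exact h1

lemma decayWeight_two_mul {d : ℕ} (M : ℝ) (y : RD d) :
    decayWeight (2 * M) y = decayWeight M y * decayWeight M y := by
  have hy : 0 < 1 + ‖y‖ := by positivity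
  rw [decayWeight, decayWeight, ← ENNReal.ofReal_mul (by positivity), ← Real.rpow_add hy]
  ring_nf

lemma lintegral_decayWeight_lt_top {d : ℕ} {M : ℝ} (hM : (d : ℝ) < M) :
    ∫⁻ y : RD d, decayWeight M y < ⊤ :=
  finite_integral_one_add_norm (by simpa using hM)

lemma two_pow_mul_lintegral_decayWeight {d : ℕ} (M : ℝ) (μ : ℕ) (p : RD d) :
    (2 : ℝ≥0∞) ^ ((μ : ℝ) * (d : ℝ)) * ∫⁻ z, decayWeight M ((2 : ℝ) ^ μ • (p - z)) =
      ∫⁻ y : RD d, decayWeight M y := by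
  have hne : (2 : ℝ) ^ μ ≠ 0 := by positivity
  rw [lintegral_sub_left_eq_self (fun z => decayWeight M ((2 : ℝ) ^ μ • z)) p]
  have hmap := Measure.map_addHaar_smul (volume : Measure (RD d)) hne
  have h1 := lintegral_map (μ := (volume : Measure (RD d))) (measurable_decayWeight (d := d) M)
    (measurable_const_smul ((2 : ℝ) ^ μ))
  rw [hmap, lintegral_smul_measure] at h1
  rw [← h1, smul_eq_mul, ← mul_assoc, finrank_euclideanSpace, Fintype.card_fin,
    abs_of_pos (by positivity), ENNReal.ofReal_inv_of_pos (by positivity), ← pow_mul,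
    ENNReal.ofReal_pow (by positivity), ENNReal.ofReal_ofNat, ← ENNReal.rpow_natCast,
    Nat.cast_mul, ENNReal.mul_inv_cancel, one_mul]
  · simp
  · exact ENNReal.rpow_ne_top_of_nonneg (by positivity) (by norm_num)

lemma dyadicCube_eq_preimage (d : ℕ) (ν : ℤ) (n : Fin d → ℤ) :
    dyadicCube d ν n = WithLp.ofLp ⁻¹' (Set.univ.pi fun i =>
      Set.Ico ((n i : ℝ) * (2 : ℝ) ^ (-ν)) (((n i : ℝ) + 1) * (2 : ℝ) ^ (-ν))) := by
  ext x
  simp [dyadicCube]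

lemma measurableSet_dyadicCube (d : ℕ) (ν : ℤ) (n : Fin d → ℤ) :
    MeasurableSet (dyadicCube d ν n) := by
  rw [dyadicCube_eq_preimage]
  exact (MeasurableSet.univ_pi fun i => measurableSet_Ico).preimage
    (PiLp.volume_preserving_ofLp (Fin d)).measurable

lemma volume_dyadicCube (d μ : ℕ) (n : Fin d → ℤ) :
    (2 : ℝ≥0∞) ^ ((μ : ℝ) * (d : ℝ)) * volume (dyadicCube d μ n) = 1 := by
  rw [dyadicCube_eq_preimage, (PiLp.volume_preserving_ofLp (Fin d)).measure_preimage
    (MeasurableSet.univ_pi fun i => measurableSet_Ico).nullMeasurableSet, volume_pi_pi]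
  have h : ∀ i, ((n i : ℝ) + 1) * (2 : ℝ) ^ (-(μ : ℤ)) - (n i : ℝ) * (2 : ℝ) ^ (-(μ : ℤ)) =
      ((2 : ℝ) ^ μ)⁻¹ := by
    intro i
    rw [zpow_neg, zpow_natCast]
    ring
  simp only [Real.volume_Ico, h, Finset.prod_const, Finset.card_univ, Fintype.card_fin]
  rw [ENNReal.ofReal_inv_of_pos (by positivity), ENNReal.ofReal_pow (by positivity),
    ENNReal.ofReal_ofNat, ENNReal.rpow_mul, ENNReal.rpow_natCast, ENNReal.rpow_natCast,
    ← mul_pow, ENNReal.mul_inv_cancel (by simp) (by simp), one_pow]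

lemma mem_dyadicCube_iff {d : ℕ} {ν : ℤ} {n : Fin d → ℤ} {x : RD d} :
    x ∈ dyadicCube d ν n ↔ ∀ i, ⌊x i * (2 : ℝ) ^ ν⌋ = n i := by
  have h2 : (0 : ℝ) < 2 ^ ν := by positivity
  refine forall_congr' fun i => ?_
  rw [Int.floor_eq_iff, zpow_neg, ← div_eq_mul_inv, ← div_eq_mul_inv, div_le_iff₀ h2,
    lt_div_iff₀ h2]

lemma lintegral_eq_tsum_dyadicCube {d : ℕ} (ν : ℤ) (f : RD d → ℝ≥0∞) :
    ∫⁻ x, f x = ∑' n : Fin d → ℤ, ∫⁻ x in dyadicCube d ν n, f x := by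
  rw [← lintegral_iUnion (fun n => measurableSet_dyadicCube d ν n)]
  · have : ⋃ n, dyadicCube d ν n = Set.univ := Set.eq_univ_of_forall fun x =>
      Set.mem_iUnion.mpr ⟨fun i => ⌊x i * (2 : ℝ) ^ ν⌋, mem_dyadicCube_iff.mpr fun i => rfl⟩
    rw [this, Measure.restrict_univ]
  · intro n n' hnn
    refine Set.disjoint_left.mpr fun x hx hx' => hnn (funext fun i => ?_)
    rw [← mem_dyadicCube_iff.mp hx i, ← mem_dyadicCube_iff.mp hx' i]

lemma norm_smul_sub_le_of_mem_dyadicCube {d μ : ℕ} {n : Fin d → ℤ} {x y : RD d}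
    (hx : x ∈ dyadicCube d μ n) (hy : y ∈ dyadicCube d μ n) :
    ‖(2 : ℝ) ^ μ • (x - y)‖ ≤ √d := by
  rw [EuclideanSpace.norm_eq]
  refine Real.sqrt_le_sqrt ?_
  calc ∑ i, ‖((2 : ℝ) ^ μ • (x - y)) i‖ ^ 2 ≤ ∑ i : Fin d, (1 : ℝ) := by
        refine Finset.sum_le_sum fun i _ => ?_
        have h1 := hx i
        have h2 := hy i
        rw [zpow_neg, zpow_natCast, ← div_eq_mul_inv, ← div_eq_mul_inv,
          div_le_iff₀ (by positivity), lt_div_iff₀ (by positivity)] at h1 h2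
        rw [Real.norm_eq_abs, sq_abs, ← sq_abs, sq_le_one_iff₀ (abs_nonneg _), abs_le]
        simp only [PiLp.smul_apply, PiLp.sub_apply, smul_eq_mul]
        constructor <;> nlinarith
    _ = d := by simp

lemma dyadicCube_nonempty (d μ : ℕ) (n : Fin d → ℤ) : (dyadicCube d μ n).Nonempty := by
  refine nonempty_of_measure_ne_zero (μ := volume) fun h => ?_
  simpa [h] using volume_dyadicCube d μ n

/-- A weighted integral is controlled by the averages over cubes of the scale of the weight. -/
lemma exists_lintegral_decayWeight_mul_le (d : ℕ) {M : ℝ} (hM : (d : ℝ) < M) :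
    ∃ C : ℝ≥0, ∀ (μ : ℕ) (p : RD d) (H : RD d → ℝ≥0∞),
      (2 : ℝ≥0∞) ^ ((μ : ℝ) * (d : ℝ)) * ∫⁻ z, decayWeight M ((2 : ℝ) ^ μ • (p - z)) * H z ≤
        C * ⨆ n : Fin d → ℤ,
          (2 : ℝ≥0∞) ^ ((μ : ℝ) * (d : ℝ)) * ∫⁻ x in dyadicCube d μ n, H x := by
  have hM0 : 0 ≤ M := (Nat.cast_nonneg d).trans hM.le
  set c : ℝ≥0∞ := ENNReal.ofReal ((1 + √d) ^ M) with hc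
  set I : ℝ≥0∞ := ∫⁻ y : RD d, decayWeight M y with hI
  have hItop : I ≠ ⊤ := (lintegral_decayWeight_lt_top hM).ne
  have hctop : c ≠ ⊤ := ENNReal.ofReal_ne_top
  refine ⟨(c * c * I).toNNReal, fun μ p H => ?_⟩
  rw [ENNReal.coe_toNNReal (by finiteness)]
  set T : ℝ≥0∞ := (2 : ℝ≥0∞) ^ ((μ : ℝ) * (d : ℝ)) with hT
  have hTtop : T ≠ ⊤ := ENNReal.rpow_ne_top_of_nonneg (by positivity) (by norm_num)
  set S : ℝ≥0∞ := ⨆ n : Fin d → ℤ, T * ∫⁻ x in dyadicCube d μ n, H x with hS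
  set v : RD d → ℝ≥0∞ := fun z => decayWeight M ((2 : ℝ) ^ μ • (p - z)) with hv
  have hvle : ∀ n : Fin d → ℤ, ∀ z ∈ dyadicCube d μ n, ∀ z' ∈ dyadicCube d μ n,
      v z ≤ c * v z' := by
    intro n z hz z' hz'
    refine decayWeight_le_mul hM0 (by positivity) ?_
    have h1 : (2 : ℝ) ^ μ • (p - z') = (2 : ℝ) ^ μ • (p - z) + (2 : ℝ) ^ μ • (z - z') := by
      rw [← smul_add]; congr 1; abel
    have h2 := norm_add_le ((2 : ℝ) ^ μ • (p - z)) ((2 : ℝ) ^ μ • (z - z'))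
    rw [← h1] at h2
    have h3 := norm_smul_sub_le_of_mem_dyadicCube hz hz'
    nlinarith [norm_nonneg ((2 : ℝ) ^ μ • (p - z)), Real.sqrt_nonneg d]
  have hcube : ∀ n : Fin d → ℤ, T * ∫⁻ z in dyadicCube d μ n, v z * H z ≤
      T * ∫⁻ z in dyadicCube d μ n, c * c * S * v z := by
    intro n
    obtain ⟨r, hr⟩ := dyadicCube_nonempty d μ n
    calc T * ∫⁻ z in dyadicCube d μ n, v z * H z
        ≤ T * ∫⁻ z in dyadicCube d μ n, c * v r * H z := by
          gcongr 1
          refine setLIntegral_mono' (measurableSet_dyadicCube d μ n) fun z hz => ?_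
          gcongr
          exact hvle n z hz r hr
      _ = c * v r * (T * ∫⁻ z in dyadicCube d μ n, H z) := by
          have hvr : v r ≠ ⊤ := ENNReal.ofReal_ne_top
          rw [lintegral_const_mul' _ _ (ENNReal.mul_ne_top hctop hvr)]
          ring
      _ ≤ c * v r * S := by
          gcongr
          exact le_iSup (fun n : Fin d → ℤ => T * ∫⁻ x in dyadicCube d μ n, H x) n
      _ = T * ∫⁻ z in dyadicCube d μ n, c * v r * S := by
          rw [setLIntegral_const, mul_left_comm, volume_dyadicCube, mul_one]
      _ ≤ T * ∫⁻ z in dyadicCube d μ n, c * c * S * v z := by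
          gcongr 1
          refine setLIntegral_mono' (measurableSet_dyadicCube d μ n) fun z hz => ?_
          calc c * v r * S ≤ c * (c * v z) * S := by
                gcongr
                exact hvle n r hr z hz
            _ = c * c * S * v z := by ring
  have hvm : Measurable v := by
    have := measurable_decayWeight (d := d) M
    fun_prop
  calc T * ∫⁻ z, v z * H z
      = ∑' n, T * ∫⁻ z in dyadicCube d μ n, v z * H z := by
        rw [lintegral_eq_tsum_dyadicCube μ, ENNReal.tsum_mul_left]
    _ ≤ ∑' n, T * ∫⁻ z in dyadicCube d μ n, c * c * S * v z := ENNReal.tsum_le_tsum hcube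
    _ = c * c * S * (T * ∫⁻ z, v z) := by
        rw [ENNReal.tsum_mul_left, ← lintegral_eq_tsum_dyadicCube μ, lintegral_const_mul _ hvm]
        ring
    _ = c * c * I * S := by
        rw [two_pow_mul_lintegral_decayWeight]
        ring

/-- Averages at scale `2 ^ (-l)` of a function, integrated over a larger dyadic cube. -/
lemma exists_setLIntegral_dyadicCube_le (d : ℕ) {M : ℝ} (hM : (d : ℝ) < M) :
    ∃ C : ℝ≥0, ∀ (μ l : ℕ), μ ≤ l → ∀ (n : Fin d → ℤ), ∀ p ∈ dyadicCube d μ n,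
      ∀ f : RD d → ℝ≥0∞, Measurable f →
      ∫⁻ x in dyadicCube d μ n, ∫⁻ y, decayWeight (2 * M) y * f (x - ((2 : ℝ) ^ l)⁻¹ • y) ≤
        C * ∫⁻ z, decayWeight M ((2 : ℝ) ^ μ • (p - z)) * f z := by
  have hM0 : 0 ≤ M := (Nat.cast_nonneg d).trans hM.le
  set c : ℝ≥0∞ := ENNReal.ofReal ((1 + √d) ^ M) with hc
  set I : ℝ≥0∞ := ∫⁻ y : RD d, decayWeight M y with hI
  have hItop : I ≠ ⊤ := (lintegral_decayWeight_lt_top hM).ne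
  have hctop : c ≠ ⊤ := ENNReal.ofReal_ne_top
  have hdm := measurable_decayWeight (d := d) (2 * M)
  have hdm' := measurable_decayWeight (d := d) M
  refine ⟨(c * I).toNNReal, fun μ l hμl n p hp f hf => ?_⟩
  rw [ENNReal.coe_toNNReal (by finiteness)]
  set a : ℝ := ((2 : ℝ) ^ l)⁻¹ with ha
  have hapos : 0 < a := by positivity
  set P := dyadicCube d μ n with hP
  have hPm : MeasurableSet P := measurableSet_dyadicCube d μ n
  set χ : RD d → ℝ≥0∞ := P.indicator 1 with hχ
  have hχm : Measurable χ := measurable_one.indicator hPm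
  have hkey : ∀ z y, χ (z + a • y) * decayWeight (2 * M) y ≤
      c * decayWeight M ((2 : ℝ) ^ μ • (p - z)) * decayWeight M y := by
    intro z y
    by_cases hzy : z + a • y ∈ P
    · rw [hχ, Set.indicator_of_mem hzy, Pi.one_apply, one_mul, decayWeight_two_mul]
      gcongr
      refine decayWeight_le_mul hM0 (by positivity) ?_
      have h1 : (2 : ℝ) ^ μ • (p - z) =
          (2 : ℝ) ^ μ • (p - (z + a • y)) + ((2 : ℝ) ^ μ * a) • y := by
        rw [mul_smul, ← smul_add]; congr 1; abel
      have h2 := norm_add_le ((2 : ℝ) ^ μ • (p - (z + a • y))) (((2 : ℝ) ^ μ * a) • y)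
      rw [← h1] at h2
      have h3 := norm_smul_sub_le_of_mem_dyadicCube hp hzy
      have h4 : (2 : ℝ) ^ μ * a ≤ 1 := by
        rw [ha, mul_inv_le_iff₀ (by positivity), one_mul]
        exact pow_le_pow_right₀ (by norm_num) hμl
      have h5 : ‖((2 : ℝ) ^ μ * a) • y‖ ≤ ‖y‖ := by
        rw [norm_smul, Real.norm_of_nonneg (by positivity)]
        exact mul_le_of_le_one_left (norm_nonneg y) h4
      nlinarith [norm_nonneg y, Real.sqrt_nonneg d]
    · rw [hχ, Set.indicator_of_notMem hzy, zero_mul]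
      exact zero_le
  calc ∫⁻ x in P, ∫⁻ y, decayWeight (2 * M) y * f (x - a • y)
      = ∫⁻ x, ∫⁻ y, χ x * (decayWeight (2 * M) y * f (x - a • y)) := by
        rw [← lintegral_indicator hPm]
        refine lintegral_congr fun x => ?_
        by_cases hx : x ∈ P
        · simp [hχ, hx]
        · simp [hχ, hx]
    _ = ∫⁻ y, ∫⁻ x, χ x * (decayWeight (2 * M) y * f (x - a • y)) :=
        lintegral_lintegral_swap (by fun_prop)
    _ = ∫⁻ y, ∫⁻ z, χ (z + a • y) * (decayWeight (2 * M) y * f z) := by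
        refine lintegral_congr fun y => ?_
        rw [← lintegral_add_right_eq_self _ (a • y)]
        simp only [add_sub_cancel_right]
    _ = ∫⁻ z, ∫⁻ y, χ (z + a • y) * (decayWeight (2 * M) y * f z) :=
        lintegral_lintegral_swap (by fun_prop)
    _ ≤ ∫⁻ z, ∫⁻ y, c * (decayWeight M ((2 : ℝ) ^ μ • (p - z)) * f z) * decayWeight M y := by
        refine lintegral_mono fun z => lintegral_mono fun y => ?_
        calc χ (z + a • y) * (decayWeight (2 * M) y * f z)
            = χ (z + a • y) * decayWeight (2 * M) y * f z := by ring
          _ ≤ c * decayWeight M ((2 : ℝ) ^ μ • (p - z)) * decayWeight M y * f z :=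
              mul_le_mul_left (hkey z y) _
          _ = _ := by ring
    _ = ∫⁻ z, c * I * (decayWeight M ((2 : ℝ) ^ μ • (p - z)) * f z) := by
        refine lintegral_congr fun z => ?_
        rw [lintegral_const_mul _ hdm']
        ring
    _ = c * I * ∫⁻ z, decayWeight M ((2 : ℝ) ^ μ • (p - z)) * f z :=
        lintegral_const_mul' _ _ (by finiteness)

lemma tsum_two_rpow_mul_ite_le (t κ : ℝ) (h k μ : ℕ) :
    ∑' j : ℕ, (2 : ℝ≥0∞) ^ (t * ((μ + j : ℕ) : ℝ)) *
      (if μ + j ≤ k + h then (2 : ℝ≥0∞) ^ (κ * ((k + h - (μ + j) : ℕ) : ℝ)) else 0) ≤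
    (2 : ℝ≥0∞) ^ (t * h) * (1 - (2 : ℝ≥0∞) ^ (-(t - κ)))⁻¹ *
      (if μ ≤ k + h then (2 : ℝ≥0∞) ^ (t * k) else 0) := by
  by_cases hμ : μ ≤ k + h
  · rw [if_pos hμ]
    calc _ = ∑' j : ℕ, (2 : ℝ≥0∞) ^ (t * h) * (2 : ℝ≥0∞) ^ (t * k) *
          (if μ + j ≤ k + h then ((2 : ℝ≥0∞) ^ (-(t - κ))) ^ (k + h - (μ + j)) else 0) := by
          refine tsum_congr fun j => ?_
          by_cases hj : μ + j ≤ k + h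
          · rw [if_pos hj, if_pos hj, ← two_rpow_mul_natCast,
              ← ENNReal.rpow_add _ _ (by simp) (by simp),
              ← ENNReal.rpow_add _ _ (by simp) (by simp),
              ← ENNReal.rpow_add _ _ (by simp) (by simp)]
            congr 1
            rw [Nat.cast_sub hj]
            push_cast
            ring
          · rw [if_neg hj, if_neg hj, mul_zero, mul_zero]
      _ ≤ (2 : ℝ≥0∞) ^ (t * h) * (2 : ℝ≥0∞) ^ (t * k) * (1 - (2 : ℝ≥0∞) ^ (-(t - κ)))⁻¹ := by
          rw [ENNReal.tsum_mul_left]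
          gcongr
          refine tsum_ite_pow_le (P := fun j => μ + j ≤ k + h) (fun i hi j hj hij => ?_) _
          simp only [Set.mem_ofPred_eq] at hi hj
          omega
      _ = _ := by ring
  · rw [if_neg hμ, mul_zero]
    refine (ENNReal.tsum_eq_zero.mpr fun j => ?_).le
    rw [if_neg (by omega), mul_zero]

lemma tsum_ite_le_add_eq (h μ : ℕ) (a : ℕ → ℝ≥0∞) :
    ∑' k, (if μ ≤ k + h then a k else 0) = ∑' j, a (μ - h + j) := by
  have hinj : Function.Injective fun j : ℕ => μ - h + j := add_right_injective _
  rw [← hinj.tsum_eq]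
  · refine tsum_congr fun j => if_pos ?_
    omega
  · intro k hk
    have : μ ≤ k + h := by
      by_contra hlt
      exact hk (if_neg hlt)
    exact ⟨k - (μ - h), by dsimp only; omega⟩

/-- The `q`-th power form of the Nikol'skii-type estimate. -/
lemma exists_setLIntegral_tsum_LP_le {d : ℕ} (D : LPData d) {q s A : ℝ} {h : ℕ} (hq : 0 < q)
    (hs : (d : ℝ) / min 1 q - d < s) (hA : 1 < A) (hAh : A < 2 ^ h) :
    ∃ C : ℝ≥0, ∀ (μ : ℕ), 1 ≤ μ → ∀ (n : Fin d → ℤ) (F : ℕ → RD d → ℂ),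
      (∀ k, Function.HasTemperateGrowth (F k)) →
      (∀ k : ℕ, HasFourierSupportIn (F k) {ξ : RD d | ‖ξ‖ ≤ A * (2 : ℝ) ^ k}) →
      (2 : ℝ≥0∞) ^ ((μ : ℝ) * (d : ℝ)) * ∫⁻ x in dyadicCube d μ n,
        ∑' j : ℕ, (2 : ℝ≥0∞) ^ (s * q * ((μ + j : ℕ) : ℝ)) *
          ‖∑' k : ℕ, LP D (μ + j) (F k) x‖ₑ ^ q ≤
      C * ⨆ n' : Fin d → ℤ, (2 : ℝ≥0∞) ^ ((μ : ℝ) * (d : ℝ)) * ∫⁻ x in dyadicCube d μ n',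
        ∑' j : ℕ, (2 : ℝ≥0∞) ^ (s * q * ((μ - h + j : ℕ) : ℝ)) * ‖F (μ - h + j) x‖ₑ ^ q := by
  have hM : (d : ℝ) < d + 1 := lt_add_one _
  have hd : (0 : ℝ) ≤ d := Nat.cast_nonneg d
  have hmin : 0 < min 1 q := lt_min one_pos hq
  have hs0 : 0 < s := by
    have : (d : ℝ) ≤ d / min 1 q := le_div_self hd hmin (min_le_left _ _)
    linarith
  set κ : ℝ := d * (1 - min 1 q) + s / 2 * (max 1 q - 1) with hκ
  have hκs : κ < s * q := by
    rcases le_total 1 q with h1 | h1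
    · rw [hκ, min_eq_left h1, max_eq_right h1]
      nlinarith
    · rw [min_eq_right h1, div_sub' hq.ne', div_lt_iff₀ hq] at hs
      rw [hκ, min_eq_right h1, max_eq_left h1]
      linarith
  obtain ⟨C₁, hC₁⟩ := exists_enorm_tsum_LP_rpow_le D hA hAh hq (half_pos hs0) (2 * ((d : ℝ) + 1))
  obtain ⟨C₂, hC₂⟩ := exists_setLIntegral_dyadicCube_le d hM
  obtain ⟨C₃, hC₃⟩ := exists_lintegral_decayWeight_mul_le d hM
  set E : ℝ≥0∞ := (2 : ℝ≥0∞) ^ (s * q * h) * (1 - (2 : ℝ≥0∞) ^ (-(s * q - κ)))⁻¹ with hE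
  have hEtop : E ≠ ⊤ := ENNReal.mul_ne_top
    (ENNReal.rpow_ne_top_of_nonneg (by positivity) (by norm_num))
    (one_sub_two_rpow_neg_inv_ne_top (sub_pos.mpr hκs))
  refine ⟨C₁ * C₂ * E.toNNReal * C₃, fun μ hμ n F hF hsupp => ?_⟩
  rw [ENNReal.coe_mul, ENNReal.coe_mul, ENNReal.coe_mul, ENNReal.coe_toNNReal hEtop]
  obtain ⟨p, hp⟩ := dyadicCube_nonempty d μ n
  set T : ℝ≥0∞ := (2 : ℝ≥0∞) ^ ((μ : ℝ) * (d : ℝ)) with hT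
  set W : ℕ → ℕ → ℝ≥0∞ := fun j k =>
    if μ + j ≤ k + h then (2 : ℝ≥0∞) ^ (κ * ((k + h - (μ + j) : ℕ) : ℝ)) else 0 with hW
  set J : ℕ → ℕ → RD d → ℝ≥0∞ := fun j k x => ∫⁻ y, decayWeight (2 * ((d : ℝ) + 1)) y *
    ‖F k (x - ((2 : ℝ) ^ (μ + j))⁻¹ • y)‖ₑ ^ q with hJ
  set v : RD d → ℝ≥0∞ := fun z => decayWeight ((d : ℝ) + 1) ((2 : ℝ) ^ μ • (p - z)) with hv
  have hdw := measurable_decayWeight (d := d) (2 * ((d : ℝ) + 1))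
  have hdw' := measurable_decayWeight (d := d) ((d : ℝ) + 1)
  have hvm : Measurable v := by fun_prop
  have hFm : ∀ k, Measurable fun z => ‖F k z‖ₑ ^ q := fun k =>
    ((hF k).1.continuous.measurable.enorm).pow_const q
  have hJm : ∀ j k, Measurable (J j k) := by
    intro j k
    have hk := hFm k
    refine Measurable.lintegral_prod_right' (f := fun z : RD d × RD d =>
      decayWeight (2 * ((d : ℝ) + 1)) z.2 *
        ‖F k (z.1 - ((2 : ℝ) ^ (μ + j))⁻¹ • z.2)‖ₑ ^ q) ?_
    exact (hdw.comp measurable_snd).mul (hk.comp (by fun_prop))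
  have hpt : ∀ x j, ‖∑' k : ℕ, LP D (μ + j) (F k) x‖ₑ ^ q ≤
      C₁ * ∑' k, W j k * J j k x := by
    intro x j
    refine (hC₁ (μ + j) (by omega) F hF hsupp x).trans_eq ?_
    congr 1
    refine tsum_congr fun k => ?_
    simp only [hW, hJ, hκ, ite_mul, zero_mul]
  have hint : ∫⁻ x in dyadicCube d μ n, ∑' j : ℕ, (2 : ℝ≥0∞) ^ (s * q * ((μ + j : ℕ) : ℝ)) *
      ‖∑' k : ℕ, LP D (μ + j) (F k) x‖ₑ ^ q ≤
      C₁ * C₂ * E * ∫⁻ z, v z * ∑' j : ℕ,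
        (2 : ℝ≥0∞) ^ (s * q * ((μ - h + j : ℕ) : ℝ)) * ‖F (μ - h + j) z‖ₑ ^ q := by
    calc _ ≤ ∫⁻ x in dyadicCube d μ n, ∑' j : ℕ, ∑' k : ℕ,
          C₁ * ((2 : ℝ≥0∞) ^ (s * q * ((μ + j : ℕ) : ℝ)) * W j k) * J j k x := by
          refine lintegral_mono fun x => ENNReal.tsum_le_tsum fun j => ?_
          refine (mul_le_mul_right (hpt x j) _).trans_eq ?_
          rw [← ENNReal.tsum_mul_left, ← ENNReal.tsum_mul_left]
          exact tsum_congr fun k => by ring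
      _ = ∑' j : ℕ, ∑' k : ℕ, C₁ * ((2 : ℝ≥0∞) ^ (s * q * ((μ + j : ℕ) : ℝ)) * W j k) *
          ∫⁻ x in dyadicCube d μ n, J j k x := by
          rw [lintegral_tsum fun j =>
            (Measurable.tsum fun k => (hJm j k).const_mul _).aemeasurable]
          refine tsum_congr fun j => ?_
          rw [lintegral_tsum fun k => ((hJm j k).const_mul _).aemeasurable]
          exact tsum_congr fun k => lintegral_const_mul _ (hJm j k)
      _ ≤ ∑' j : ℕ, ∑' k : ℕ, C₁ * ((2 : ℝ≥0∞) ^ (s * q * ((μ + j : ℕ) : ℝ)) * W j k) *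
          (C₂ * ∫⁻ z, v z * ‖F k z‖ₑ ^ q) := by
          refine ENNReal.tsum_le_tsum fun j => ENNReal.tsum_le_tsum fun k =>
            mul_le_mul_right ?_ _
          exact hC₂ μ (μ + j) (by omega) n p hp _ (hFm k)
      _ = C₁ * C₂ * ∑' k : ℕ, (∑' j : ℕ, (2 : ℝ≥0∞) ^ (s * q * ((μ + j : ℕ) : ℝ)) * W j k) *
          ∫⁻ z, v z * ‖F k z‖ₑ ^ q := by
          rw [ENNReal.tsum_comm, ← ENNReal.tsum_mul_left]
          refine tsum_congr fun k => ?_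
          rw [← ENNReal.tsum_mul_right, ← ENNReal.tsum_mul_left]
          exact tsum_congr fun j => by ring
      _ ≤ C₁ * C₂ * ∑' k : ℕ, E * (if μ ≤ k + h then (2 : ℝ≥0∞) ^ (s * q * k) else 0) *
          ∫⁻ z, v z * ‖F k z‖ₑ ^ q := by
          refine mul_le_mul_right (ENNReal.tsum_le_tsum fun k => mul_le_mul_left ?_ _) _
          exact tsum_two_rpow_mul_ite_le (s * q) κ h k μ
      _ = C₁ * C₂ * E * ∑' k : ℕ, if μ ≤ k + h then
          (2 : ℝ≥0∞) ^ (s * q * k) * ∫⁻ z, v z * ‖F k z‖ₑ ^ q else 0 := by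
          rw [mul_assoc (_ * _)]
          congr 1
          rw [← ENNReal.tsum_mul_left]
          refine tsum_congr fun k => ?_
          rw [mul_assoc, ite_mul, zero_mul]
      _ = _ := by
          rw [tsum_ite_le_add_eq]
          congr 1
          simp_rw [← ENNReal.tsum_mul_left]
          have hm : ∀ j, Measurable fun z =>
              v z * ((2 : ℝ≥0∞) ^ (s * q * ((μ - h + j : ℕ) : ℝ)) * ‖F (μ - h + j) z‖ₑ ^ q) :=
            fun j => hvm.mul ((hFm _).const_mul _)
          rw [lintegral_tsum fun j => (hm j).aemeasurable]
          refine tsum_congr fun j => ?_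
          have hm' : Measurable fun z => v z * ‖F (μ - h + j) z‖ₑ ^ q := hvm.mul (hFm _)
          rw [← lintegral_const_mul _ hm']
          exact lintegral_congr fun z => by ring
  calc _ ≤ T * (C₁ * C₂ * E * ∫⁻ z, v z * ∑' j : ℕ,
        (2 : ℝ≥0∞) ^ (s * q * ((μ - h + j : ℕ) : ℝ)) * ‖F (μ - h + j) z‖ₑ ^ q) :=
        mul_le_mul_right hint _
    _ = C₁ * C₂ * E * (T * ∫⁻ z, v z * ∑' j : ℕ,
        (2 : ℝ≥0∞) ^ (s * q * ((μ - h + j : ℕ) : ℝ)) * ‖F (μ - h + j) z‖ₑ ^ q) := by ring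
    _ ≤ _ := by
        rw [mul_assoc _ (C₃ : ℝ≥0∞)]
        exact mul_le_mul_right (hC₃ μ p _) _

lemma cubePiece_eq {d : ℕ} (μ : ℕ) (n : Fin d → ℤ) (k₀ : ℕ) (s q : ℝ) (g : ℕ → RD d → ℂ) :
    cubePiece d μ n k₀ s q g = ((2 : ℝ≥0∞) ^ ((μ : ℝ) * (d : ℝ)) * ∫⁻ x in dyadicCube d μ n,
      ∑' j : ℕ, (2 : ℝ≥0∞) ^ (s * q * ((k₀ + j : ℕ) : ℝ)) * ‖g (k₀ + j) x‖ₑ ^ q) ^ (1 / q) := by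
  simp only [cubePiece, enorm_eq_nnnorm, Nat.cast_add, mul_right_comm s q]

/-- Nikol'skii-type estimate for families with Fourier support in balls
`{|ξ| ≤ A·2^k}`, valid for `s > τ_q = d/min(1,q) - d`, with the supremum on the right
over dyadic cubes of the same level `μ`. -/
theorem statement8 (d : ℕ) (hd : 1 ≤ d) (q : ℝ) (hq : 0 < q) (s : ℝ)
    (hs : s > (d : ℝ) / min 1 q - d) (A : ℝ) (hA : 1 < A)
    (D : LPData d) :
    ∃ (h : ℕ) (C : ℝ≥0), ∀ (μ : ℕ), 1 ≤ μ → ∀ (n : Fin d → ℤ) (F : ℕ → RD d → ℂ),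
      (∀ k, Function.HasTemperateGrowth (F k)) →
      (∀ k : ℕ, HasFourierSupportIn (F k) {ξ : RD d | ‖ξ‖ ≤ A * (2:ℝ)^k}) →
      (∀ ψ : 𝓢(RD d, ℂ), Summable (fun k : ℕ => ∫ x, F k x * ψ x)) →
      cubePiece d μ n μ s q (fun l x => ∑' k : ℕ, LP D l (F k) x) ≤
        (C : ℝ≥0∞) * ⨆ n' : Fin d → ℤ, cubePiece d μ n' (μ - h) s q F := by
  obtain ⟨h, hh⟩ := pow_unbounded_of_one_lt A (one_lt_two : (1 : ℝ) < 2)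
  obtain ⟨C, hC⟩ := exists_setLIntegral_tsum_LP_le D hq hs hA hh
  refine ⟨h, C ^ (1 / q), fun μ hμ n F hF hsupp _ => ?_⟩
  have hq' : 0 ≤ 1 / q := by positivity
  simp only [cubePiece_eq]
  refine (ENNReal.rpow_le_rpow (hC μ hμ n F hF hsupp) hq').trans_eq ?_
  rw [ENNReal.mul_rpow_of_nonneg _ _ hq', ENNReal.coe_rpow_of_nonneg _ hq']
  congr 1
  exact (ENNReal.orderIsoRpow (1 / q) (by positivity)).map_iSup _

end
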